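/- (Second-order expansion of the C-block) Let M : [0,∞) → ℝ^{d×d} be continuously differentiable with ‖M(t)‖₂ ≤ L_M and ‖M(t) − M(0)‖₂ ≤ L_M' for all t ∈ [0,1]. With Φ(t) = [[A(t),B(t)],[C(t),D(t)]] the fundamental solution of Φ' = [[0,I],[M(t),0]]Φ, Φ(0)=I, one has for all t ∈ [0,1]: ‖C(t) − t·M(0)‖₂ ≤ ((L_M' + L_M²/2)/√L_M)·sinh(√L_M t). -/

import Mathlib

lemma aux_norm_le {E : Type*} [NormedAddCommGroup E] [NormedSpace ℝ E] (f f' : ℝ → E)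
    (B B' : ℝ → ℝ) (b : ℝ) (hf : ∀ t, 0 ≤ t → HasDerivAt f (f' t) t) (h0 : ‖f 0‖ ≤ B 0)
    (hB : ∀ t, HasDerivAt B (B' t) t) (h : ∀ t ∈ Set.Icc (0 : ℝ) b, ‖f' t‖ ≤ B' t) :
    ∀ t ∈ Set.Icc (0 : ℝ) b, ‖f t‖ ≤ B t := by
  intro t ht
  exact image_norm_le_of_norm_deriv_right_le_deriv_boundary
    (fun x hx => (hf x hx.1).continuousAt.continuousWithinAt)
    (fun x hx => (hf x hx.1).hasDerivWithinAt) h0 hB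
    (fun x hx => h x ⟨hx.1, hx.2.le⟩) ht

lemma aux_sinh_le (u : ℝ) (hu : 0 ≤ u) : Real.sinh u ≤ u * Real.cosh u := by
  have := aux_norm_le Real.sinh Real.cosh (fun x => x * Real.cosh x)
    (fun x => 1 * Real.cosh x + x * Real.sinh x) u (fun t _ => Real.hasDerivAt_sinh t)
    (by simp) (fun t => (hasDerivAt_id t).mul (Real.hasDerivAt_cosh t))
    (fun t ht => by
      rw [Real.norm_eq_abs, abs_of_pos (Real.cosh_pos t)]
      have := mul_nonneg ht.1 (Real.sinh_nonneg_iff.2 ht.1)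
      linarith) u ⟨hu, le_rfl⟩
  exact (le_abs_self _).trans this

lemma aux_cosh_le (y : ℝ) (hy : 0 ≤ y) : Real.cosh y - 1 ≤ y ^ 2 / 2 * Real.cosh y := by
  obtain ⟨u, rfl⟩ : ∃ u, y = 2 * u := ⟨y / 2, by ring⟩
  have hu : 0 ≤ u := by linarith
  have h1 := aux_sinh_le u hu
  have h2 := Real.sinh_nonneg_iff.2 hu
  have h3 := pow_le_pow_left₀ h2 h1 2
  have h4 := mul_nonneg (sq_nonneg u) (sq_nonneg (Real.sinh u))
  rw [Real.cosh_two_mul, Real.cosh_sq]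
  rw [mul_pow, Real.cosh_sq] at h3
  nlinarith

lemma aux_pow (c : ℝ) (n : ℕ) (t : ℝ) :
    HasDerivAt (fun t : ℝ => (c * t) ^ (n + 1) / ((n + 1).factorial : ℝ))
      (c * ((c * t) ^ n / (n.factorial : ℝ))) t := by
  have h := ((((hasDerivAt_id t).const_mul c).pow (n + 1)).div_const ((n + 1).factorial : ℝ))
  refine h.congr_deriv ?_
  have : (n.factorial : ℝ) ≠ 0 := by positivity
  simp [Nat.factorial_succ]
  field_simp

lemma aux_sinh (c t : ℝ) :
    HasDerivAt (fun t : ℝ => Real.sinh (c * t)) (c * Real.cosh (c * t)) t := by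
  refine (((hasDerivAt_id t).const_mul c).sinh).congr_deriv ?_
  simp [mul_comm]

lemma aux_cosh (c t : ℝ) :
    HasDerivAt (fun t : ℝ => Real.cosh (c * t)) (c * Real.sinh (c * t)) t := by
  refine (((hasDerivAt_id t).const_mul c).cosh).congr_deriv ?_
  simp [mul_comm]

/-- Second-order expansion of the `C`-block of the fundamental solution
`Φ = [[A,B],[C,D]]` of `Φ' = [[0,I],[M(t),0]] Φ`, `Φ(0) = I`, for `t ∈ [0,1]`:
if `‖M(t)‖ ≤ L_M` and `‖M(t) − M(0)‖ ≤ L_M'` on `[0,1]`, then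
`‖C(t) − t·M(0)‖ ≤ ((L_M' + L_M²/2)/√L_M)·sinh(√L_M t)`. -/
theorem matrix_exponent_C_block_second_order (d : ℕ) (LM LM' : ℝ) (hLM : 0 < LM)
    (M : ℝ → EuclideanSpace ℝ (Fin d) →L[ℝ] EuclideanSpace ℝ (Fin d))
    (hMdiff : ∀ t, DifferentiableAt ℝ M t) (hMderiv_cont : Continuous (deriv M))
    (hM : ∀ t ∈ Set.Icc (0 : ℝ) 1, ‖M t‖ ≤ LM)
    (hM' : ∀ t ∈ Set.Icc (0 : ℝ) 1, ‖M t - M 0‖ ≤ LM')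
    (A B C D : ℝ → EuclideanSpace ℝ (Fin d) →L[ℝ] EuclideanSpace ℝ (Fin d))
    (hA0 : A 0 = ContinuousLinearMap.id ℝ (EuclideanSpace ℝ (Fin d)))
    (hB0 : B 0 = 0) (hC0 : C 0 = 0)
    (hD0 : D 0 = ContinuousLinearMap.id ℝ (EuclideanSpace ℝ (Fin d)))
    (hA : ∀ t, 0 ≤ t → HasDerivAt A (C t) t)
    (hB : ∀ t, 0 ≤ t → HasDerivAt B (D t) t)
    (hC : ∀ t, 0 ≤ t → HasDerivAt C ((M t).comp (A t)) t)
    (hD : ∀ t, 0 ≤ t → HasDerivAt D ((M t).comp (B t)) t)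
    (t : ℝ) (ht : t ∈ Set.Icc (0 : ℝ) 1) :
    ‖C t - t • M 0‖ ≤
      ((LM' + LM ^ 2 / 2) / Real.sqrt LM) * Real.sinh (Real.sqrt LM * t) := by
  obtain ⟨c, hc, rfl⟩ : ∃ c : ℝ, 0 < c ∧ LM = c ^ 2 :=
    ⟨Real.sqrt LM, Real.sqrt_pos.2 hLM, (Real.sq_sqrt hLM.le).symm⟩
  rw [Real.sqrt_sq hc.le]
  have hAd : ∀ t, 0 ≤ t →
      HasDerivAt (fun t => A t - ContinuousLinearMap.id ℝ (EuclideanSpace ℝ (Fin d))) (C t) t :=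
    fun t ht => (hA t ht).sub_const _
  have hid : ‖ContinuousLinearMap.id ℝ (EuclideanSpace ℝ (Fin d))‖ ≤ 1 :=
    ContinuousLinearMap.norm_id_le
  obtain ⟨K, hK⟩ : ∃ K, ∀ t ∈ Set.Icc (0 : ℝ) 1,
      ‖A t - ContinuousLinearMap.id ℝ (EuclideanSpace ℝ (Fin d))‖ ≤ K :=
    isCompact_Icc.exists_bound_of_continuousOn
      (fun x hx => (hAd x hx.1).continuousAt.continuousWithinAt)
  have key : ∀ n : ℕ, ∀ t ∈ Set.Icc (0 : ℝ) 1,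
      ‖A t - ContinuousLinearMap.id ℝ (EuclideanSpace ℝ (Fin d))‖ ≤
        Real.cosh (c * t) - 1 + K * ((c * t) ^ (2 * n) / ((2 * n).factorial : ℝ)) := by
    intro n
    induction n with
    | zero =>
      intro t ht
      have := Real.one_le_cosh (c * t)
      have := hK t ht
      simp
      linarith
    | succ n ih =>
      have h1 := aux_norm_le C _
        (fun t => c * (Real.sinh (c * t) +
          K * ((c * t) ^ (2 * n + 1) / ((2 * n + 1).factorial : ℝ)))) _ 1 hC
        (by simp [hC0])
        (fun t => ((aux_sinh c t).add ((aux_pow c (2 * n) t).const_mul K)).const_mul c)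
        (fun t ht => by
          have e : A t = (A t - ContinuousLinearMap.id ℝ (EuclideanSpace ℝ (Fin d))) +
            ContinuousLinearMap.id ℝ (EuclideanSpace ℝ (Fin d)) := by abel
          have hAt : ‖A t‖ ≤
              Real.cosh (c * t) + K * ((c * t) ^ (2 * n) / ((2 * n).factorial : ℝ)) := by
            rw [e]
            refine (norm_add_le _ _).trans ?_
            linarith [ih t ht]
          refine (ContinuousLinearMap.opNorm_comp_le _ _).trans ?_
          refine (mul_le_mul (hM t ht) hAt (norm_nonneg _) (by positivity)).trans (le_of_eq ?_)
          ring)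
      refine aux_norm_le _ C _ _ 1 hAd (by simp [hA0])
        (fun t => ((aux_cosh c t).sub_const 1).add ((aux_pow c (2 * n + 1) t).const_mul K)) ?_
      intro t ht
      refine (h1 t ht).trans (le_of_eq ?_)
      ring
  have hAb : ∀ t ∈ Set.Icc (0 : ℝ) 1,
      ‖A t - ContinuousLinearMap.id ℝ (EuclideanSpace ℝ (Fin d))‖ ≤ Real.cosh (c * t) - 1 := by
    intro t ht
    have hl : Filter.Tendsto (fun n : ℕ => Real.cosh (c * t) - 1 +
        K * ((c * t) ^ (2 * n) / ((2 * n).factorial : ℝ))) Filter.atTop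
        (nhds (Real.cosh (c * t) - 1 + K * 0)) := by
      refine Filter.Tendsto.const_add _ (Filter.Tendsto.const_mul _ ?_)
      exact (FloorSemiring.tendsto_pow_div_factorial_atTop (c * t)).comp
        (Filter.tendsto_id.const_mul_atTop' (by norm_num : 0 < 2))
    have := ge_of_tendsto' hl (fun n => key n t ht)
    simpa using this
  have hL' : 0 ≤ LM' := (norm_nonneg _).trans (hM' t ht)
  refine aux_norm_le (fun t => C t - t • M 0) _
    (fun t => (LM' + (c ^ 2) ^ 2 / 2) / c * Real.sinh (c * t)) _ 1
    (fun t ht => (hC t ht).sub ((hasDerivAt_id t).smul_const (M 0)))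
    (by
      have hz : (0 : ℝ) • M 0 = 0 := zero_smul ℝ (M 0)
      simp [hC0, hz])
    (fun t => (aux_sinh c t).const_mul _) ?_ t ht
  intro s hs
  have e : (M s).comp (A s) - (1 : ℝ) • M 0 = (M s - M 0) +
      (M s).comp (A s - ContinuousLinearMap.id ℝ (EuclideanSpace ℝ (Fin d))) := by
    ext x
    simp
  rw [e]
  have hcs : 0 ≤ c * s := mul_nonneg hc.le hs.1
  have h1 : ‖(M s).comp (A s - ContinuousLinearMap.id ℝ (EuclideanSpace ℝ (Fin d)))‖ ≤
      c ^ 2 * (c ^ 2 / 2 * Real.cosh (c * s)) := by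
    refine (ContinuousLinearMap.opNorm_comp_le _ _).trans ?_
    refine mul_le_mul (hM s hs) ?_ (norm_nonneg _) (by positivity)
    refine (hAb s hs).trans ((aux_cosh_le _ hcs).trans ?_)
    have : (c * s) ^ 2 ≤ c ^ 2 :=
      pow_le_pow_left₀ hcs (mul_le_of_le_one_right hc.le hs.2) 2
    have := Real.cosh_pos (c * s)
    gcongr
  have h2 : LM' ≤ LM' * Real.cosh (c * s) :=
    le_mul_of_one_le_right hL' (Real.one_le_cosh _)
  have h3 : (LM' + (c ^ 2) ^ 2 / 2) / c * (c * Real.cosh (c * s)) =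
      LM' * Real.cosh (c * s) + c ^ 2 * (c ^ 2 / 2 * Real.cosh (c * s)) := by
    field_simp
  rw [h3]
  exact (norm_add_le _ _).trans (add_le_add ((hM' s hs).trans h2) h1)
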